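/- Define A(t) = G(−t)·v(−t)² and B(t) = H(−t)·v(−t)², where v(t) = φ(t)/φ(t²). Then A and B satisfy the system: H(t)·A(t) + G(t)·B(t) = 2·φ(t²)²/φ(t)², and H(−t)·A(t) − G(−t)·B(t) = 0. Moreover, A and B are the unique pair of power series satisfying this system. -/

import Mathlib

open PowerSeries

noncomputable instance : TopologicalSpace (PowerSeries ℚ) :=
  inferInstanceAs (TopologicalSpace ((Unit →₀ ℕ) → ℚ))

/-- `G(q^j) = ∏_{n ≥ 1} 1/((1 - q^{j(5n-1)})(1 - q^{j(5n-4)}))`, the first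
Rogers–Ramanujan product evaluated at `q^j`. -/
noncomputable def G (j : ℕ) : PowerSeries ℚ :=
  ∏' n : ℕ, ((1 - (X : ℚ⟦X⟧) ^ (j * (5 * n + 4))) * (1 - X ^ (j * (5 * n + 1))))⁻¹

/-- `H(q^j) = ∏_{n ≥ 1} 1/((1 - q^{j(5n-2)})(1 - q^{j(5n-3)}))`, the second
Rogers–Ramanujan product evaluated at `q^j`. -/
noncomputable def H (j : ℕ) : PowerSeries ℚ :=
  ∏' n : ℕ, ((1 - (X : ℚ⟦X⟧) ^ (j * (5 * n + 3))) * (1 - X ^ (j * (5 * n + 2))))⁻¹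

/-- `φ(q^j) = ∏_{n ≥ 1} (1 - q^{j n})`. -/
noncomputable def phi (j : ℕ) : PowerSeries ℚ :=
  ∏' n : ℕ, (1 - (X : ℚ⟦X⟧) ^ (j * (n + 1)))

/-- The substitution `q ↦ -q`, a ring endomorphism of `ℚ⟦q⟧`. -/
noncomputable def neg : PowerSeries ℚ →+* PowerSeries ℚ := rescale (-1)

/-- `v(t) = φ(t)/φ(t²)`. -/
noncomputable def v : PowerSeries ℚ := phi 1 * (phi 2)⁻¹

/-- `A(t) = G(−t)·v(−t)²`. -/
noncomputable def A : PowerSeries ℚ := neg (G 1) * neg v ^ 2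

/-- `B(t) = H(−t)·v(−t)²`. -/
noncomputable def B : PowerSeries ℚ := neg (H 1) * neg v ^ 2

namespace RogersRamanujan

instance : T3Space ℚ⟦X⟧ := inferInstanceAs (T3Space ((Unit →₀ ℕ) → ℚ))

instance : IsTopologicalRing ℚ⟦X⟧ := WithPiTopology.instIsTopologicalRing ℚ

theorem hasSum_iff_coeff {ι : Type*} {f : ι → ℚ⟦X⟧} {g : ℚ⟦X⟧} :
    HasSum f g ↔ ∀ d, HasSum (fun i ↦ coeff d (f i)) (coeff d g) :=
  WithPiTopology.hasSum_iff_hasSum_coeff ℚ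

theorem summable_iff_coeff {ι : Type*} {f : ι → ℚ⟦X⟧} :
    Summable f ↔ ∀ d, Summable (fun i ↦ coeff d (f i)) :=
  WithPiTopology.summable_iff_summable_coeff ℚ

theorem continuous_coeff (d : ℕ) : Continuous (coeff (R := ℚ) d) :=
  WithPiTopology.continuous_coeff ℚ d

/-- A family of power series whose `n`-th member is `1` modulo `X ^ n` is multipliable. -/
theorem multipliable_of_X_pow_dvd {f : ℕ → ℚ⟦X⟧} (hf : ∀ n, X ^ n ∣ f n - 1) :
    Multipliable f := by
  have h : Multipliable fun n ↦ 1 + (f n - 1) := by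
    refine WithPiTopology.multipliable_one_add_of_tendsto_order_atTop_nhds_top ℚ ?_
    refine ENat.tendsto_nhds_top_iff_natCast_lt.mpr fun n ↦ ?_
    filter_upwards [Filter.eventually_ge_atTop (n + 1)] with m hm
    refine lt_of_lt_of_le ?_ (nat_le_order _ m (X_pow_dvd_iff.mp (hf m)))
    exact_mod_cast hm
  simpa using h

theorem X_pow_dvd_tprod_sub {f : ℕ → ℚ⟦X⟧} (hf : ∀ n, X ^ n ∣ f n - 1) (N : ℕ) :
    X ^ N ∣ ∏' n, f n - ∏ n ∈ Finset.range N, f n := by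
  have key : ∀ N' ≥ N, X ^ N ∣ ∏ n ∈ Finset.range N', f n - ∏ n ∈ Finset.range N, f n := by
    intro N' hN'
    induction N', hN' using Nat.le_induction with
    | base => simp
    | succ n hn ih =>
      have : ∏ i ∈ Finset.range (n + 1), f i - ∏ i ∈ Finset.range N, f i =
          (∏ i ∈ Finset.range n, f i) * (f n - 1) +
            (∏ i ∈ Finset.range n, f i - ∏ i ∈ Finset.range N, f i) := by
        rw [Finset.prod_range_succ]; ring
      rw [this]
      exact dvd_add (Dvd.dvd.mul_left ((pow_dvd_pow X hn).trans (hf n)) _) ih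
  rw [X_pow_dvd_iff]
  intro m hm
  have h1 := (((continuous_coeff m).tendsto _).comp
    (multipliable_of_X_pow_dvd hf).hasProd.tendsto_prod_nat)
  have h2 : Filter.Tendsto (fun k ↦ coeff m (∏ n ∈ Finset.range k, f n)) Filter.atTop
      (nhds (coeff m (∏ n ∈ Finset.range N, f n))) := by
    refine tendsto_const_nhds.congr' ?_
    filter_upwards [Filter.eventually_ge_atTop N] with k hk
    have := X_pow_dvd_iff.mp (key k hk) m hm
    rw [map_sub, sub_eq_zero] at this
    exact this.symm
  rw [map_sub, sub_eq_zero]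
  exact tendsto_nhds_unique h1 h2

/-- The product `∏_{n ≥ 0} (1 - X ^ (K n + a))`. -/
noncomputable def progProd (K a : ℕ) : ℚ⟦X⟧ := ∏' n : ℕ, (1 - X ^ (K * n + a))

theorem X_pow_dvd_one_sub_X_pow_sub_one {K a : ℕ} (hK : 0 < K) (n : ℕ) :
    (X : ℚ⟦X⟧) ^ n ∣ 1 - X ^ (K * n + a) - 1 := by
  have : (1 : ℚ⟦X⟧) - X ^ (K * n + a) - 1 = - X ^ (K * n + a) := by ring
  rw [this, dvd_neg]
  exact pow_dvd_pow X (by nlinarith)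

theorem multipliable_progProd {K : ℕ} (hK : 0 < K) (a : ℕ) :
    Multipliable fun n : ℕ ↦ (1 - X ^ (K * n + a) : ℚ⟦X⟧) :=
  multipliable_of_X_pow_dvd (X_pow_dvd_one_sub_X_pow_sub_one hK)

theorem tendsto_progProd {K : ℕ} (hK : 0 < K) (a : ℕ) :
    Filter.Tendsto (fun N ↦ ∏ n ∈ Finset.range N, (1 - X ^ (K * n + a) : ℚ⟦X⟧)) Filter.atTop
      (nhds (progProd K a)) :=
  (multipliable_progProd hK a).hasProd.tendsto_prod_nat

theorem constantCoeff_progProd {K a : ℕ} (hK : 0 < K) (ha : 0 < a) :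
    constantCoeff (progProd K a) = 1 := by
  have h := X_pow_dvd_tprod_sub (X_pow_dvd_one_sub_X_pow_sub_one (a := a) hK) 1
  rw [pow_one, X_dvd_iff, map_sub, sub_eq_zero] at h
  rw [progProd, h]
  simp [ha.ne']

theorem progProd_ne_zero {K a : ℕ} (hK : 0 < K) (ha : 0 < a) : progProd K a ≠ 0 := by
  intro h
  simpa [h] using constantCoeff_progProd hK ha

/-- Splitting the index of `progProd` by its residue modulo `d`. -/
theorem progProd_eq_prod {K d : ℕ} (hK : 0 < K) (hd : 0 < d) (a : ℕ) :
    progProd K a = ∏ i ∈ Finset.range d, progProd (K * d) (K * i + a) := by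
  have h1 : Filter.Tendsto (fun N ↦ d * N) Filter.atTop Filter.atTop :=
    Filter.tendsto_id.const_mul_atTop' hd
  refine tendsto_nhds_unique ((tendsto_progProd hK a).comp h1) ?_
  have h2 := tendsto_finsetProd (Finset.range d) fun i _ ↦
    tendsto_progProd (Nat.mul_pos hK hd) (K * i + a)
  refine h2.congr fun N ↦ ?_
  rw [Finset.prod_comm]
  induction N with
  | zero => simp
  | succ N ih =>
    rw [Finset.prod_range_succ, ih]
    simp only [Function.comp_apply, Nat.mul_succ, Finset.prod_range_add]
    congr 1
    refine Finset.prod_congr rfl fun i _ ↦ ?_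
    congr 2
    ring

/-! ### The Jacobi triple product -/

/-- The `q`-factorial `(q; q)_N`. -/
noncomputable def qfact (q : ℚ⟦X⟧) (N : ℕ) : ℚ⟦X⟧ := ∏ j ∈ Finset.range N, (1 - q ^ (j + 1))

/-- The inverse `1 / (q; q)_m`, extended by zero to negative `m`. -/
noncomputable def qfactInv (q : ℚ⟦X⟧) (m : ℤ) : ℚ⟦X⟧ :=
  if 0 ≤ m then (qfact q m.toNat)⁻¹ else 0

theorem qfact_succ (q : ℚ⟦X⟧) (N : ℕ) : qfact q (N + 1) = qfact q N * (1 - q ^ (N + 1)) :=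
  Finset.prod_range_succ _ _

theorem qfactInv_natCast (q : ℚ⟦X⟧) (m : ℕ) : qfactInv q m = (qfact q m)⁻¹ := by
  simp [qfactInv]

theorem qfactInv_of_neg (q : ℚ⟦X⟧) {m : ℤ} (hm : m < 0) : qfactInv q m = 0 := by
  simp [qfactInv, hm]

theorem constantCoeff_qfact {q : ℚ⟦X⟧} (hq : constantCoeff q = 0) (N : ℕ) :
    constantCoeff (qfact q N) = 1 := by
  simp [qfact, map_prod, hq]

theorem qfact_mul_qfactInv {q : ℚ⟦X⟧} (hq : constantCoeff q = 0) (m : ℕ) :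
    qfact q m * qfactInv q m = 1 := by
  rw [qfactInv_natCast]
  exact PowerSeries.mul_inv_cancel _ (by simp [constantCoeff_qfact hq])

theorem qfactInv_pred {q : ℚ⟦X⟧} (hq : constantCoeff q = 0) (m : ℕ) :
    qfactInv q ((m : ℤ) - 1) = (1 - q ^ m) * qfactInv q m := by
  cases m with
  | zero => simp [qfactInv_of_neg]
  | succ m =>
    have h1 := qfact_mul_qfactInv hq m
    have h2 := qfact_mul_qfactInv hq (m + 1)
    rw [qfact_succ] at h2
    rw [show ((m + 1 : ℕ) : ℤ) - 1 = m by push_cast; ring]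
    linear_combination (1 - q ^ (m + 1)) * qfactInv q ((m + 1 : ℕ) : ℤ) * h1 - qfactInv q m * h2

/-- The central `q`-binomial coefficient `[2N, N + n]`. -/
noncomputable def qcentral (q : ℚ⟦X⟧) (N : ℕ) (n : ℤ) : ℚ⟦X⟧ :=
  qfact q (2 * N) * qfactInv q (N - n) * qfactInv q (N + n)

theorem qfact_mul_qfactInv_rec {q : ℚ⟦X⟧} (hq : constantCoeff q = 0) {N a b : ℕ}
    (hab : a + b = 2 * N + 2) :
    qfact q (2 * N + 2) * qfactInv q a * qfactInv q b =
      (1 + q ^ (2 * N + 1)) * (qfact q (2 * N) * qfactInv q (a - 1) * qfactInv q (b - 1)) +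
      q ^ a * (qfact q (2 * N) * qfactInv q a * qfactInv q (b - 2)) +
      q ^ b * (qfact q (2 * N) * qfactInv q (a - 2) * qfactInv q b) := by
  have pred2 : ∀ m : ℕ, qfactInv q (((m + 1 : ℕ) : ℤ) - 2) =
      (1 - q ^ m) * ((1 - q ^ (m + 1)) * qfactInv q (m + 1 : ℕ)) := by
    intro m
    rw [← qfactInv_pred hq (m + 1), show ((m + 1 : ℕ) : ℤ) - 1 = m by push_cast; ring,
      ← qfactInv_pred hq m]
    congr 1; push_cast; ring
  have hfact : qfact q (2 * N + 2) =
      qfact q (2 * N) * (1 - q ^ (2 * N + 1)) * (1 - q ^ (2 * N + 2)) := by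
    rw [qfact_succ, qfact_succ]
  rcases a with _ | a
  · obtain rfl : b = 2 * N + 1 + 1 := by omega
    rw [pred2 (2 * N + 1), hfact, qfactInv_of_neg q (m := ((0 : ℕ) : ℤ) - 1) (by norm_num),
      qfactInv_of_neg q (m := ((0 : ℕ) : ℤ) - 2) (by norm_num)]
    ring
  rcases b with _ | b
  · obtain rfl : a = 2 * N + 1 := by omega
    rw [pred2 (2 * N + 1), hfact, qfactInv_of_neg q (m := ((0 : ℕ) : ℤ) - 1) (by norm_num),
      qfactInv_of_neg q (m := ((0 : ℕ) : ℤ) - 2) (by norm_num)]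
    ring
  rw [pred2 a, pred2 b, hfact, qfactInv_pred hq, qfactInv_pred hq]
  have h : q ^ (2 * N) = q ^ a * q ^ b := by rw [← pow_add]; congr 1; omega
  rw [pow_succ q (2 * N), show q ^ (2 * N + 2) = q ^ (2 * N) * q ^ 2 from pow_add _ _ _, h]
  ring

/-- The sign `(-1) ^ n`. -/
noncomputable def sgn (n : ℤ) : ℚ⟦X⟧ := if Even n then 1 else -1

theorem sgn_add_one (n : ℤ) : sgn (n + 1) = - sgn n := by
  by_cases h : Even n <;> simp [sgn, h]

theorem sgn_sub_one (n : ℤ) : sgn (n - 1) = - sgn n := by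
  have := sgn_add_one (n - 1)
  rw [sub_add_cancel] at this
  rw [this, neg_neg]

/-- The exponent `K n (n - 1) / 2 + a n` in the theta series. -/
def thetaExp (K a : ℕ) (n : ℤ) : ℕ := (K * (n * (n - 1) / 2) + a * n).toNat

theorem two_mul_thetaExp {K a : ℕ} (haK : a ≤ K) (n : ℤ) :
    2 * (thetaExp K a n : ℤ) = K * (n * (n - 1)) + 2 * (a * n) := by
  have h2 : n * (n - 1) / 2 * 2 = n * (n - 1) :=
    Int.ediv_mul_cancel (by simpa [mul_comm] using (Int.even_mul_pred_self n).two_dvd)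
  have hnn : 0 ≤ K * (n * (n - 1) / 2) + a * n := by
    have ha : (0 : ℤ) ≤ a := by positivity
    have haK' : (a : ℤ) ≤ K := by exact_mod_cast haK
    rcases le_or_gt 0 n with hn | hn
    · have : 0 ≤ n * (n - 1) / 2 := by
        rcases hn.eq_or_lt with rfl | hn
        · simp
        · exact Int.ediv_nonneg (mul_nonneg hn.le (by omega)) (by norm_num)
      have hK : (0 : ℤ) ≤ K := by positivity
      positivity
    · have : -n ≤ n * (n - 1) / 2 := by
        nlinarith
      nlinarith
  rw [thetaExp, Int.toNat_of_nonneg hnn]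
  linear_combination (K : ℤ) * h2

theorem natAbs_le_thetaExp {K a : ℕ} (ha : 0 < a) (haK : a < K) (n : ℤ) :
    n.natAbs ≤ thetaExp K a n := by
  have h := two_mul_thetaExp haK.le n
  have ha' : (1 : ℤ) ≤ a := by exact_mod_cast ha
  have haK' : (a : ℤ) + 1 ≤ K := by exact_mod_cast haK
  have : 0 ≤ n * (n - 1) := by
    rcases le_or_gt n 0 with hn | hn
    · nlinarith
    · nlinarith
  rcases le_or_gt 0 n with hn | hn
  · have : n ≤ thetaExp K a n := by nlinarith [mul_nonneg (by linarith : (0 : ℤ) ≤ K) this]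
    omega
  · have h1 : 0 ≤ (n * (n - 1) + 2 * n) := by nlinarith
    have : -n ≤ thetaExp K a n := by nlinarith [mul_nonneg (by linarith : (0 : ℤ) ≤ K) h1]
    omega

/-- The finite form of the Jacobi triple product. -/
theorem hasSum_finite_triple {K a : ℕ} (ha : 0 < a) (haK : a < K) (N : ℕ) :
    HasSum (fun n : ℤ ↦ sgn n * X ^ thetaExp K a n * qcentral (X ^ K) N n)
      ((∏ n ∈ Finset.range N, (1 - X ^ (K * n + a))) *
        ∏ n ∈ Finset.range N, (1 - X ^ (K * n + (K - a)))) := by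
  have hq : constantCoeff ((X : ℚ⟦X⟧) ^ K) = 0 := by simp [(ha.trans haK).ne']
  induction N with
  | zero =>
    have := hasSum_single (f := fun n : ℤ ↦ sgn n * X ^ thetaExp K a n * qcentral (X ^ K) 0 n) 0
      (by
        intro n hn
        have : qcentral (X ^ K : ℚ⟦X⟧) 0 n = 0 := by
          rcases lt_or_gt_of_ne hn with h | h
          · simp [qcentral, qfactInv_of_neg _ h]
          · simp [qcentral, qfactInv_of_neg (X ^ K : ℚ⟦X⟧) (m := -n) (by omega)]
        simp [this])
    simpa [sgn, thetaExp, qcentral, qfactInv, qfact] using this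
  | succ N ih =>
    have hsub := (Equiv.subRight (1 : ℤ)).hasSum_iff.mpr ih
    have hadd := (Equiv.addRight (1 : ℤ)).hasSum_iff.mpr ih
    have := ((ih.mul_left (1 + X ^ (K * (2 * N + 1)))).sub
      (hsub.mul_left (X ^ (K * N + a)))).sub (hadd.mul_left (X ^ (K * N + (K - a))))
    convert! this using 1
    · funext n
      simp only [Function.comp_apply, Equiv.subRight_apply, Equiv.coe_addRight, sgn_add_one,
        sgn_sub_one]
      by_cases hn : n.natAbs ≤ N + 1
      · obtain ⟨A, hA⟩ : ∃ A : ℕ, (A : ℤ) = N + 1 - n := ⟨(N + 1 - n).toNat, by omega⟩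
        obtain ⟨B, hB⟩ : ∃ B : ℕ, (B : ℤ) = N + 1 + n := ⟨(N + 1 + n).toNat, by omega⟩
        have key := qfact_mul_qfactInv_rec hq (N := N) (a := A) (b := B) (by omega)
        have e0 := two_mul_thetaExp haK.le n
        have e1 := two_mul_thetaExp haK.le (n - 1)
        have e2 := two_mul_thetaExp haK.le (n + 1)
        have p1 : (X : ℚ⟦X⟧) ^ (K * N + a) * X ^ thetaExp K a (n - 1) =
            X ^ thetaExp K a n * (X ^ K) ^ A := by
          rw [← pow_add, ← pow_mul, ← pow_add]
          congr 1
          zify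
          rw [hA]
          refine mul_left_cancel₀ (two_ne_zero (α := ℤ)) ?_
          linear_combination e1 - e0
        have p2 : (X : ℚ⟦X⟧) ^ (K * N + (K - a)) * X ^ thetaExp K a (n + 1) =
            X ^ thetaExp K a n * (X ^ K) ^ B := by
          rw [← pow_add, ← pow_mul, ← pow_add]
          congr 1
          zify [haK.le]
          rw [hB]
          refine mul_left_cancel₀ (two_ne_zero (α := ℤ)) ?_
          linear_combination e2 - e0
        have c0 : qcentral (X ^ K : ℚ⟦X⟧) (N + 1) n = qfact (X ^ K) (2 * N + 2) *
            qfactInv (X ^ K) A * qfactInv (X ^ K) B := by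
          rw [hA, hB, qcentral]; push_cast; rfl
        have c1 : qcentral (X ^ K : ℚ⟦X⟧) N n = qfact (X ^ K) (2 * N) *
            qfactInv (X ^ K) (A - 1) * qfactInv (X ^ K) (B - 1) := by
          rw [hA, hB, qcentral]; congr 2 <;> [congr 1; skip] <;> ring
        have c2 : qcentral (X ^ K : ℚ⟦X⟧) N (n - 1) = qfact (X ^ K) (2 * N) *
            qfactInv (X ^ K) A * qfactInv (X ^ K) (B - 2) := by
          rw [hA, hB, qcentral]; congr 2 <;> [congr 1; skip] <;> ring
        have c3 : qcentral (X ^ K : ℚ⟦X⟧) N (n + 1) = qfact (X ^ K) (2 * N) *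
            qfactInv (X ^ K) (A - 2) * qfactInv (X ^ K) B := by
          rw [hA, hB, qcentral]; congr 2 <;> [congr 1; skip] <;> ring
        rw [← c0, ← c1, ← c2, ← c3] at key
        rw [key, pow_mul X K (2 * N + 1)]
        linear_combination (-sgn n * qcentral (X ^ K) N (n - 1)) * p1 +
          (-sgn n * qcentral (X ^ K) N (n + 1)) * p2
      · have vanish : ∀ (M : ℕ) (m : ℤ), M < m.natAbs → qcentral (X ^ K : ℚ⟦X⟧) M m = 0 := by
          intro M m hm
          rcases le_or_gt 0 m with h | h
          · simp [qcentral, qfactInv_of_neg (X ^ K : ℚ⟦X⟧) (m := M - m) (by omega)]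
          · simp [qcentral, qfactInv_of_neg (X ^ K : ℚ⟦X⟧) (m := M + m) (by omega)]
        rw [vanish _ _ (by omega), vanish _ _ (by omega), vanish _ _ (by omega),
          vanish _ _ (by omega)]
        ring
    · rw [Finset.prod_range_succ, Finset.prod_range_succ]
      have : (X : ℚ⟦X⟧) ^ (K * N + a) * X ^ (K * N + (K - a)) = X ^ (K * (2 * N + 1)) := by
        rw [← pow_add]; congr 1; zify [haK.le]; ring
      linear_combination ((∏ n ∈ Finset.range N, (1 - X ^ (K * n + a))) *
        ∏ n ∈ Finset.range N, (1 - X ^ (K * n + (K - a)))) * this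

/-- The **Jacobi triple product**, specialised to `z = -X ^ a` and `q = X ^ K`. -/
theorem hasSum_triple {K a : ℕ} (ha : 0 < a) (haK : a < K) :
    HasSum (fun n : ℤ ↦ sgn n * X ^ thetaExp K a n)
      (progProd K K * progProd K a * progProd K (K - a)) := by
  have hK := ha.trans haK
  have hq : constantCoeff ((X : ℚ⟦X⟧) ^ K) = 0 := by simp [hK.ne']
  rw [hasSum_iff_coeff]
  intro M
  set D := M + 1 with hD
  have approx : ∀ b : ℕ, ∀ m ≥ D,
      (X : ℚ⟦X⟧) ^ D ∣ progProd K b - ∏ n ∈ Finset.range m, (1 - X ^ (K * n + b)) :=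
    fun b m hm ↦ (pow_dvd_pow X hm).trans
      (X_pow_dvd_tprod_sub (X_pow_dvd_one_sub_X_pow_sub_one hK) m)
  have approxQ : ∀ m ≥ D, (X : ℚ⟦X⟧) ^ D ∣ progProd K K - qfact (X ^ K) m := by
    intro m hm
    have := approx K m hm
    simpa only [qfact, ← pow_mul, Nat.mul_succ] using this
  have coeff_eq : ∀ f g : ℚ⟦X⟧, X ^ D ∣ f - g → coeff M f = coeff M g := by
    intro f g h
    have := X_pow_dvd_iff.mp h M (by omega)
    rwa [map_sub, sub_eq_zero] at this
  have h := hasSum_iff_coeff.mp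
    ((hasSum_finite_triple ha haK (2 * D)).mul_left (progProd K K)) M
  convert h using 1
  · funext n
    refine coeff_eq _ _ ?_
    by_cases hn : n.natAbs ≤ D
    · obtain ⟨i, hi⟩ : ∃ i : ℕ, (i : ℤ) = (2 * D : ℕ) - n := ⟨((2 * D : ℕ) - n).toNat, by omega⟩
      obtain ⟨j, hj⟩ : ∃ j : ℕ, (j : ℤ) = (2 * D : ℕ) + n := ⟨((2 * D : ℕ) + n).toNat, by omega⟩
      obtain ⟨u, hu⟩ := approxQ i (by omega)
      obtain ⟨w, hw⟩ := approxQ j (by omega)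
      obtain ⟨y, hy⟩ := approxQ (2 * (2 * D)) (by omega)
      have hi1 := qfact_mul_qfactInv hq i
      have hj1 := qfact_mul_qfactInv hq j
      rw [qcentral, ← hi, ← hj]
      set Q := progProd K K
      set ri := qfactInv ((X : ℚ⟦X⟧) ^ K) i
      set rj := qfactInv ((X : ℚ⟦X⟧) ^ K) j
      rw [sub_eq_iff_eq_add, ← sub_eq_iff_eq_add'] at hu hw hy
      refine ⟨- sgn n * X ^ thetaExp K a n * ri * rj *
        (Q * u + Q * w - X ^ D * u * w - Q * y), ?_⟩
      rw [← hu] at hi1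
      rw [← hw] at hj1
      rw [← hy]
      linear_combination (-sgn n * X ^ thetaExp K a n) * ((Q - X ^ D * w) * rj * hi1 + hj1)
    · have h1 : (X : ℚ⟦X⟧) ^ D ∣ X ^ thetaExp K a n :=
        pow_dvd_pow X (by have := natAbs_le_thetaExp ha haK n; omega)
      obtain ⟨u, hu⟩ := h1
      rw [hu]
      exact ⟨sgn n * u - progProd K K * sgn n * u * qcentral (X ^ K) (2 * D) n, by ring⟩
  · refine coeff_eq _ _ ?_
    obtain ⟨u, hu⟩ := approx a (2 * D) (by omega)
    obtain ⟨w, hw⟩ := approx (K - a) (2 * D) (by omega)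
    rw [sub_eq_iff_eq_add] at hu hw
    rw [hu, hw]
    set P₁ := ∏ n ∈ Finset.range (2 * D), (1 - (X : ℚ⟦X⟧) ^ (K * n + a))
    set P₂ := ∏ n ∈ Finset.range (2 * D), (1 - (X : ℚ⟦X⟧) ^ (K * n + (K - a)))
    exact ⟨progProd K K * (u * X ^ D * w + u * P₂ + P₁ * w), by ring⟩

/-! ### The substitution `X ↦ -X` -/

theorem continuous_neg : Continuous neg := by
  refine continuous_iff_continuousAt.mpr fun f ↦ ?_
  refine (WithPiTopology.tendsto_iff_coeff_tendsto ℚ _ _ _).mpr fun d ↦ ?_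
  simp only [neg, coeff_rescale]
  exact ((continuous_coeff d).tendsto f).const_mul _

theorem sgn_eq_sgn {m n : ℤ} (h : m % 2 = n % 2) : sgn m = sgn n := by
  simp only [sgn, Int.even_iff, h]

theorem sgn_add (m n : ℤ) : sgn (m + n) = sgn m * sgn n := by
  by_cases hm : Even m <;> by_cases hn : Even n <;> simp [sgn, hm, hn, Int.even_add]

theorem neg_sgn (n : ℤ) : neg (sgn n) = sgn n := by
  by_cases h : Even n <;> simp [sgn, h]

theorem neg_X_pow (e : ℕ) : neg (X ^ e) = sgn e * X ^ e := by
  have : neg X = -X := by simp [neg, rescale_X]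
  rw [map_pow, this, neg_pow]
  by_cases h : Even e
  · simp [sgn, h]
  · simp [sgn, h, Nat.not_even_iff_odd.mp h]

theorem hasSum_neg {ι : Type*} {f : ι → ℚ⟦X⟧} {g : ℚ⟦X⟧} (h : HasSum f g) :
    HasSum (fun i ↦ neg (f i)) (neg g) :=
  h.map neg continuous_neg

/-! ### Products of theta series -/

theorem summable_mul_of_X_pow_natAbs_dvd {f g : ℤ → ℚ⟦X⟧} (hf : ∀ n, X ^ n.natAbs ∣ f n)
    (hg : ∀ n, X ^ n.natAbs ∣ g n) : Summable fun p : ℤ × ℤ ↦ f p.1 * g p.2 := by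
  rw [summable_iff_coeff]
  intro d
  refine summable_of_hasFiniteSupport ?_
  refine ((Finset.Icc (-d : ℤ) d ×ˢ Finset.Icc (-d : ℤ) d).finite_toSet).subset ?_
  rintro ⟨m, n⟩ hmn
  have h1 : (X : ℚ⟦X⟧) ^ (m.natAbs + n.natAbs) ∣ f m * g n := by
    rw [pow_add]; exact mul_dvd_mul (hf m) (hg n)
  have h2 : m.natAbs + n.natAbs ≤ d := by
    by_contra! hlt
    exact hmn (X_pow_dvd_iff.mp h1 d hlt)
  simp only [Finset.coe_product, Finset.coe_Icc, Set.mem_prod, Set.mem_Icc]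
  omega

/-- The points `(m, n)` at which `thetaExp 5 1 m + thetaExp 5 2 n` is even. -/
def evenPoints : Set (ℤ × ℤ) := {p | (p.1 + p.2) % 4 = 0 ∨ (p.2 - p.1) % 4 = 1}

/-- The points `(k, l)` at which the Gaussian integer `(4 l - 1) + 4 k i` is prime to `2 + i`. -/
def coprimePoints : Set (ℤ × ℤ) := {p | (4 * p.2 + 2 * p.1) % 5 ≠ 1}

/-- Division of `(10 m - 3) + (10 n - 1) i` by `3 + i`, followed by multiplication by the unit
that brings the quotient to the form `(4 l - 1) + 4 k i`. -/
def gaussDiv (p : ℤ × ℤ) : ℤ × ℤ :=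
  if (p.1 + p.2) % 4 = 0 then
    if p.1 % 2 = 0 then ((3 * p.2 - p.1) / 4, (3 * p.1 + p.2) / 4)
    else ((p.1 - 3 * p.2) / 4, (2 - 3 * p.1 - p.2) / 4)
  else
    if p.1 % 2 = 0 then ((1 - 3 * p.1 - p.2) / 4, (3 * p.2 - p.1 + 1) / 4)
    else ((3 * p.1 + p.2 - 1) / 4, (1 - 3 * p.2 + p.1) / 4)

/-- The inverse of `gaussDiv`. -/
def gaussMul (p : ℤ × ℤ) : ℤ × ℤ :=
  if (4 * p.2 + 2 * p.1) % 5 = 0 then ((6 * p.2 - 2 * p.1) / 5, (2 * p.2 + 6 * p.1) / 5)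
  else if (4 * p.2 + 2 * p.1) % 5 = 2 then
    ((3 - 6 * p.2 + 2 * p.1) / 5, (1 - 2 * p.2 - 6 * p.1) / 5)
  else if (4 * p.2 + 2 * p.1) % 5 = 4 then
    ((2 - 6 * p.1 - 2 * p.2) / 5, (6 * p.2 - 2 * p.1 - 1) / 5)
  else ((1 + 6 * p.1 + 2 * p.2) / 5, (2 + 2 * p.1 - 6 * p.2) / 5)

theorem gaussDiv_cases {m n : ℤ} (h : (m, n) ∈ evenPoints) :
    ∃ k l, gaussDiv (m, n) = (k, l) ∧
      (((m + n) % 4 = 0 ∧ m % 2 = 0 ∧ 4 * k = 3 * n - m ∧ 4 * l = 3 * m + n) ∨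
      ((m + n) % 4 = 0 ∧ m % 2 = 1 ∧ 4 * k = m - 3 * n ∧ 4 * l = 2 - 3 * m - n) ∨
      ((n - m) % 4 = 1 ∧ m % 2 = 0 ∧ 4 * k = 1 - 3 * m - n ∧ 4 * l = 3 * n - m + 1) ∨
      ((n - m) % 4 = 1 ∧ m % 2 = 1 ∧ 4 * k = 3 * m + n - 1 ∧ 4 * l = 1 - 3 * n + m)) := by
  refine ⟨(gaussDiv (m, n)).1, (gaussDiv (m, n)).2, rfl, ?_⟩
  simp only [evenPoints, Set.mem_ofPred_eq] at h
  simp only [gaussDiv]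
  split_ifs with h₀ h₁ h₁
  · exact Or.inl (by omega)
  · exact Or.inr (Or.inl (by omega))
  · exact Or.inr (Or.inr (Or.inl (by omega)))
  · exact Or.inr (Or.inr (Or.inr (by omega)))

theorem gaussMul_cases {k l : ℤ} (h : (k, l) ∈ coprimePoints) :
    ∃ m n, gaussMul (k, l) = (m, n) ∧
      (((4 * l + 2 * k) % 5 = 0 ∧ 5 * m = 6 * l - 2 * k ∧ 5 * n = 2 * l + 6 * k) ∨
      ((4 * l + 2 * k) % 5 = 2 ∧ 5 * m = 3 - 6 * l + 2 * k ∧ 5 * n = 1 - 2 * l - 6 * k) ∨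
      ((4 * l + 2 * k) % 5 = 4 ∧ 5 * m = 2 - 6 * k - 2 * l ∧ 5 * n = 6 * l - 2 * k - 1) ∨
      ((4 * l + 2 * k) % 5 = 3 ∧ 5 * m = 1 + 6 * k + 2 * l ∧ 5 * n = 2 + 2 * k - 6 * l)) := by
  refine ⟨(gaussMul (k, l)).1, (gaussMul (k, l)).2, rfl, ?_⟩
  simp only [coprimePoints, Set.mem_ofPred_eq] at h
  have hj : l = 2 * k + 4 * ((4 * l + 2 * k) % 5) +
      5 * (4 * ((4 * l + 2 * k) / 5) - 2 * k - 3 * l) := by omega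
  generalize 4 * ((4 * l + 2 * k) / 5) - 2 * k - 3 * l = j at hj
  simp only [gaussMul]
  split_ifs with h₀ h₂ h₄
  · exact Or.inl (by omega)
  · exact Or.inr (Or.inl (by omega))
  · exact Or.inr (Or.inr (Or.inl (by omega)))
  · exact Or.inr (Or.inr (Or.inr (by omega)))

/-- `gaussDiv` as a bijection. -/
def gaussEquiv : evenPoints ≃ coprimePoints where
  toFun p := ⟨gaussDiv p, by
    obtain ⟨⟨m, n⟩, h⟩ := p
    obtain ⟨k, l, e, h⟩ := gaussDiv_cases h
    simp only [e, coprimePoints, Set.mem_ofPred_eq]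
    rcases h with h | h | h | h <;> omega⟩
  invFun p := ⟨gaussMul p, by
    obtain ⟨⟨k, l⟩, h⟩ := p
    obtain ⟨m, n, e, h⟩ := gaussMul_cases h
    simp only [e, evenPoints, Set.mem_ofPred_eq]
    rcases h with h | h | h | h <;> omega⟩
  left_inv := by
    rintro ⟨⟨m, n⟩, h⟩
    obtain ⟨k, l, e, h⟩ := gaussDiv_cases h
    have hkl : (k, l) ∈ coprimePoints := by
      simp only [coprimePoints, Set.mem_ofPred_eq]; omega
    obtain ⟨m', n', e', h'⟩ := gaussMul_cases hkl
    simp only [e, e', Subtype.mk.injEq, Prod.mk.injEq]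
    omega
  right_inv := by
    rintro ⟨⟨k, l⟩, h⟩
    obtain ⟨m, n, e, h⟩ := gaussMul_cases h
    have hmn : (m, n) ∈ evenPoints := by
      simp only [evenPoints, Set.mem_ofPred_eq]; omega
    obtain ⟨k', l', e', h'⟩ := gaussDiv_cases hmn
    simp only [e, e', Subtype.mk.injEq, Prod.mk.injEq]
    omega

/-- On the points off `coprimePoints`, where `(4 l - 1) + 4 k i = (2 + i) β`, the involution
induced by complex conjugation of `β`; the identity elsewhere. -/
def conjCofactor (p : ℤ × ℤ) : ℤ × ℤ :=
  if (4 * p.2 + 2 * p.1) % 5 = 1 then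
    ((3 * p.1 - 4 * p.2 + 1) / 5, (2 - 3 * p.2 - 4 * p.1) / 5)
  else p

theorem conjCofactor_cases {k l : ℤ} (h : (k, l) ∉ coprimePoints) :
    ∃ k' l', conjCofactor (k, l) = (k', l') ∧ 5 * k' = 3 * k - 4 * l + 1 ∧
      5 * l' = 2 - 3 * l - 4 * k := by
  refine ⟨(conjCofactor (k, l)).1, (conjCofactor (k, l)).2, rfl, ?_⟩
  simp only [coprimePoints, Set.mem_ofPred_eq, not_not] at h
  simp only [conjCofactor, h, if_true]
  omega

theorem conjCofactor_of_mem {p : ℤ × ℤ} (h : p ∈ coprimePoints) : conjCofactor p = p :=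
  if_neg h

theorem conjCofactor_involutive : Function.Involutive conjCofactor := by
  rintro ⟨k, l⟩
  by_cases h : (k, l) ∈ coprimePoints
  · rw [conjCofactor_of_mem h, conjCofactor_of_mem h]
  · obtain ⟨k', l', e, h1, h2⟩ := conjCofactor_cases h
    have h' : (k', l') ∉ coprimePoints := by
      simp only [coprimePoints, Set.mem_ofPred_eq] at h ⊢; omega
    obtain ⟨k'', l'', e', h3, h4⟩ := conjCofactor_cases h'
    rw [e, e', Prod.mk.injEq]
    omega

theorem thetaExp_five_two_emod_two (n : ℤ) : (thetaExp 5 2 n : ℤ) % 2 = 0 ↔ n % 4 < 2 := by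
  have h := two_mul_thetaExp (K := 5) (a := 2) (by norm_num) n
  obtain ⟨j, r, hr, rfl⟩ : ∃ j r : ℤ, (r = 0 ∨ r = 1 ∨ r = 2 ∨ r = 3) ∧ n = 4 * j + r :=
    ⟨n / 4, n % 4, by omega, by omega⟩
  generalize (thetaExp 5 2 (4 * j + r) : ℤ) = g at *
  rcases hr with rfl | rfl | rfl | rfl <;> push_cast at h <;> ring_nf at h <;> omega

theorem thetaExp_five_one_emod_two (n : ℤ) :
    (thetaExp 5 1 n : ℤ) % 2 = 0 ↔ n % 4 = 0 ∨ n % 4 = 3 := by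
  have h := two_mul_thetaExp (K := 5) (a := 1) (by norm_num) n
  obtain ⟨j, r, hr, rfl⟩ : ∃ j r : ℤ, (r = 0 ∨ r = 1 ∨ r = 2 ∨ r = 3) ∧ n = 4 * j + r :=
    ⟨n / 4, n % 4, by omega, by omega⟩
  generalize (thetaExp 5 1 (4 * j + r) : ℤ) = g at *
  rcases hr with rfl | rfl | rfl | rfl <;> push_cast at h <;> ring_nf at h <;> omega

/-- The general term of the double series of `φ(X) H(X) φ(-X) G(-X)`. -/
noncomputable def sourceTerm (p : ℤ × ℤ) : ℚ⟦X⟧ :=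
  sgn (p.1 + p.2 + thetaExp 5 2 p.2) * X ^ (thetaExp 5 1 p.1 + thetaExp 5 2 p.2)

/-- The general term of the double series of `φ(X ^ 2) φ(X ^ 4)`. -/
noncomputable def targetTerm (p : ℤ × ℤ) : ℚ⟦X⟧ :=
  sgn (p.1 + p.2) * X ^ (thetaExp 8 4 p.1 + thetaExp 8 2 p.2)

theorem targetTerm_gaussDiv {p : ℤ × ℤ} (h : p ∈ evenPoints) :
    targetTerm (gaussDiv p) = sourceTerm p := by
  obtain ⟨m, n⟩ := p
  obtain ⟨k, l, e, h⟩ := gaussDiv_cases h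
  rw [e, targetTerm, sourceTerm]
  have hg := thetaExp_five_two_emod_two n
  have e1 := two_mul_thetaExp (K := 5) (a := 1) (by norm_num) m
  have e2 := two_mul_thetaExp (K := 5) (a := 2) (by norm_num) n
  have e3 := two_mul_thetaExp (K := 8) (a := 4) (by norm_num) k
  have e4 := two_mul_thetaExp (K := 8) (a := 2) (by norm_num) l
  push_cast at e1 e2 e3 e4
  congr 1
  · refine sgn_eq_sgn ?_
    simp only
    omega
  · congr 1
    zify
    refine mul_left_cancel₀ (by norm_num : (8 : ℤ) ≠ 0) ?_
    rcases h with ⟨-, -, hk, hl⟩ | ⟨-, -, hk, hl⟩ | ⟨-, -, hk, hl⟩ | ⟨-, -, hk, hl⟩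
    · linear_combination 4 * (e3 + e4 - e1 - e2) + 2 * (4 * k + (3 * n - m)) * hk +
        (2 * (4 * l + (3 * m + n)) - 4) * hl
    · linear_combination 4 * (e3 + e4 - e1 - e2) + 2 * (4 * k + (m - 3 * n)) * hk +
        (2 * (4 * l + (2 - 3 * m - n)) - 4) * hl
    · linear_combination 4 * (e3 + e4 - e1 - e2) + 2 * (4 * k + (1 - 3 * m - n)) * hk +
        (2 * (4 * l + (3 * n - m + 1)) - 4) * hl
    · linear_combination 4 * (e3 + e4 - e1 - e2) + 2 * (4 * k + (3 * m + n - 1)) * hk +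
        (2 * (4 * l + (1 - 3 * n + m)) - 4) * hl

theorem targetTerm_conjCofactor {p : ℤ × ℤ} (h : p ∉ coprimePoints) :
    targetTerm (conjCofactor p) = - targetTerm p := by
  obtain ⟨k, l⟩ := p
  obtain ⟨k', l', e, hk, hl⟩ := conjCofactor_cases h
  rw [e, targetTerm, targetTerm, ← neg_mul, ← sgn_add_one]
  have e1 := two_mul_thetaExp (K := 8) (a := 4) (by norm_num) k'
  have e2 := two_mul_thetaExp (K := 8) (a := 2) (by norm_num) l'
  have e3 := two_mul_thetaExp (K := 8) (a := 4) (by norm_num) k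
  have e4 := two_mul_thetaExp (K := 8) (a := 2) (by norm_num) l
  push_cast at e1 e2 e3 e4
  congr 1
  · refine sgn_eq_sgn ?_
    simp only
    omega
  · congr 1
    zify
    refine mul_left_cancel₀ (by norm_num : (50 : ℤ) ≠ 0) ?_
    linear_combination 25 * (e1 + e2 - e3 - e4) + 8 * (5 * k' + (3 * k - 4 * l + 1)) * hk +
      (8 * (5 * l' + (2 - 3 * l - 4 * k)) - 20) * hl

/-- The theta series `∑ (-1) ^ n X ^ (K n (n - 1) / 2 + a n)` in product form. -/
noncomputable def theta (K a : ℕ) : ℚ⟦X⟧ := progProd K K * progProd K a * progProd K (K - a)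

theorem X_pow_natAbs_dvd {K a : ℕ} (ha : 0 < a) (haK : a < K) (u : ℚ⟦X⟧) (n : ℤ) :
    X ^ n.natAbs ∣ u * X ^ thetaExp K a n :=
  Dvd.dvd.mul_left (pow_dvd_pow X (natAbs_le_thetaExp ha haK n)) u

theorem hasSum_sourceTerm : HasSum sourceTerm (theta 5 1 * neg (theta 5 2)) := by
  have h1 : HasSum (fun n : ℤ ↦ sgn n * X ^ thetaExp 5 1 n) (theta 5 1) :=
    hasSum_triple (by norm_num) (by norm_num)
  have h2 : HasSum (fun n : ℤ ↦ sgn n * sgn (thetaExp 5 2 n) * X ^ thetaExp 5 2 n)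
      (neg (theta 5 2)) := by
    have := hasSum_neg (hasSum_triple (K := 5) (a := 2) (by norm_num) (by norm_num))
    refine this.congr_fun fun n ↦ ?_
    rw [map_mul, neg_sgn, neg_X_pow, mul_assoc]
  have hs := summable_mul_of_X_pow_natAbs_dvd
    (fun n ↦ X_pow_natAbs_dvd (K := 5) (a := 1) (by norm_num) (by norm_num) (sgn n) n)
    (fun n ↦ X_pow_natAbs_dvd (K := 5) (a := 2) (by norm_num) (by norm_num)
      (sgn n * sgn (thetaExp 5 2 n)) n)
  refine (h1.mul h2 hs).congr_fun fun p ↦ ?_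
  rw [sourceTerm, sgn_add, sgn_add, pow_add]
  ring

theorem hasSum_targetTerm : HasSum targetTerm (theta 8 4 * theta 8 2) := by
  have h1 : HasSum (fun n : ℤ ↦ sgn n * X ^ thetaExp 8 4 n) (theta 8 4) :=
    hasSum_triple (by norm_num) (by norm_num)
  have h2 : HasSum (fun n : ℤ ↦ sgn n * X ^ thetaExp 8 2 n) (theta 8 2) :=
    hasSum_triple (by norm_num) (by norm_num)
  have hs := summable_mul_of_X_pow_natAbs_dvd
    (fun n ↦ X_pow_natAbs_dvd (K := 8) (a := 4) (by norm_num) (by norm_num) (sgn n) n)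
    (fun n ↦ X_pow_natAbs_dvd (K := 8) (a := 2) (by norm_num) (by norm_num) (sgn n) n)
  refine (h1.mul h2 hs).congr_fun fun p ↦ ?_
  rw [targetTerm, sgn_add, pow_add]
  ring

theorem theta_mul_neg_theta_add :
    theta 5 1 * neg (theta 5 2) + neg (theta 5 1 * neg (theta 5 2)) =
      2 * (theta 8 4 * theta 8 2) := by
  have hsource : HasSum (evenPoints.indicator fun p ↦ 2 * sourceTerm p)
      (theta 5 1 * neg (theta 5 2) + neg (theta 5 1 * neg (theta 5 2))) := by
    refine (hasSum_sourceTerm.add (hasSum_neg hasSum_sourceTerm)).congr_fun fun ⟨m, n⟩ ↦ ?_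
    have h1 := thetaExp_five_one_emod_two m
    have h2 := thetaExp_five_two_emod_two n
    have hs : neg (sourceTerm (m, n)) =
        sgn ((thetaExp 5 1 m : ℤ) + thetaExp 5 2 n) * sourceTerm (m, n) := by
      rw [sourceTerm, map_mul, neg_sgn, neg_X_pow]
      push_cast
      ring
    rw [hs]
    by_cases h : (m, n) ∈ evenPoints
    · have : sgn ((thetaExp 5 1 m : ℤ) + thetaExp 5 2 n) = 1 := by
        simp only [evenPoints, Set.mem_ofPred_eq] at h
        exact if_pos (Int.even_iff.mpr (by omega))
      rw [Set.indicator_of_mem h, this]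
      ring
    · have : sgn ((thetaExp 5 1 m : ℤ) + thetaExp 5 2 n) = -1 := by
        simp only [evenPoints, Set.mem_ofPred_eq] at h
        refine if_neg fun h' ↦ ?_
        rw [Int.even_iff] at h'
        omega
      rw [Set.indicator_of_notMem h, this]
      ring
  have htarget : HasSum (coprimePoints.indicator fun p ↦ 2 * targetTerm p)
      (2 * (theta 8 4 * theta 8 2)) := by
    have h := hasSum_targetTerm.add
      ((conjCofactor_involutive.toPerm conjCofactor).hasSum_iff.mpr hasSum_targetTerm)
    rw [← two_mul] at h
    refine h.congr_fun fun p ↦ ?_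
    simp only [Function.comp_apply, Function.Involutive.coe_toPerm]
    by_cases hp : p ∈ coprimePoints
    · rw [Set.indicator_of_mem hp, conjCofactor_of_mem hp, two_mul]
    · rw [Set.indicator_of_notMem hp, targetTerm_conjCofactor hp, add_neg_cancel]
  rw [← hasSum_subtype_iff_indicator] at hsource htarget
  refine hsource.unique (((gaussEquiv.hasSum_iff).mpr htarget).congr_fun fun p ↦ ?_)
  exact congrArg (2 * ·) (targetTerm_gaussDiv p.2).symm

/-! ### Watson's identity -/

theorem phi_eq_progProd (j : ℕ) : phi j = progProd j j := by
  simp only [phi, progProd, Nat.mul_succ]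

theorem phi_ne_zero {j : ℕ} (hj : 0 < j) : phi j ≠ 0 := by
  rw [phi_eq_progProd]
  exact progProd_ne_zero hj hj

theorem tprod_inv_mul_progProd {K a b : ℕ} (hK : 0 < K) (ha : 0 < a) (hb : 0 < b) :
    (∏' n : ℕ, ((1 - (X : ℚ⟦X⟧) ^ (K * n + a)) * (1 - X ^ (K * n + b)))⁻¹) *
      (progProd K a * progProd K b) = 1 := by
  have hmul : ∀ n : ℕ, ((1 - (X : ℚ⟦X⟧) ^ (K * n + a)) * (1 - X ^ (K * n + b)))⁻¹ *
      ((1 - X ^ (K * n + a)) * (1 - X ^ (K * n + b))) = 1 :=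
    fun n ↦ PowerSeries.inv_mul_cancel _ (by simp [ha.ne', hb.ne'])
  have hinv : Multipliable fun n : ℕ ↦
      ((1 - (X : ℚ⟦X⟧) ^ (K * n + a)) * (1 - X ^ (K * n + b)))⁻¹ := by
    refine multipliable_of_X_pow_dvd fun n ↦ ?_
    obtain ⟨u, hu⟩ := X_pow_dvd_one_sub_X_pow_sub_one (a := a) hK n
    obtain ⟨w, hw⟩ := X_pow_dvd_one_sub_X_pow_sub_one (a := b) hK n
    refine ⟨-((1 - (X : ℚ⟦X⟧) ^ (K * n + a)) * (1 - X ^ (K * n + b)))⁻¹ *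
      (u * (1 - X ^ (K * n + b)) + w), ?_⟩
    linear_combination hmul n - ((1 - (X : ℚ⟦X⟧) ^ (K * n + a)) * (1 - X ^ (K * n + b)))⁻¹ *
      ((1 - X ^ (K * n + b)) * hu + hw)
  have ha' := multipliable_progProd hK a
  have hb' := multipliable_progProd hK b
  rw [progProd, progProd, ← ha'.tprod_mul hb', ← hinv.tprod_mul (ha'.mul hb')]
  simp only [hmul, tprod_one]

theorem phi_one_mul_H : phi 1 * H 1 = theta 5 1 := by
  have h := tprod_inv_mul_progProd (K := 5) (a := 3) (b := 2) (by norm_num) (by norm_num)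
    (by norm_num)
  have hH : H 1 * (progProd 5 3 * progProd 5 2) = 1 := by simpa only [H, one_mul] using h
  rw [phi_eq_progProd, progProd_eq_prod (K := 1) (d := 5) (by norm_num) (by norm_num) 1, theta]
  simp only [Finset.prod_range_succ, Finset.prod_range_zero, Nat.reduceMul, Nat.reduceAdd,
    Nat.reduceSub]
  linear_combination progProd 5 1 * progProd 5 4 * progProd 5 5 * hH

theorem phi_one_mul_G : phi 1 * G 1 = theta 5 2 := by
  have h := tprod_inv_mul_progProd (K := 5) (a := 4) (b := 1) (by norm_num) (by norm_num)
    (by norm_num)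
  have hG : G 1 * (progProd 5 4 * progProd 5 1) = 1 := by simpa only [G, one_mul] using h
  rw [phi_eq_progProd, progProd_eq_prod (K := 1) (d := 5) (by norm_num) (by norm_num) 1, theta]
  simp only [Finset.prod_range_succ, Finset.prod_range_zero, Nat.reduceMul, Nat.reduceAdd,
    Nat.reduceSub]
  linear_combination progProd 5 2 * progProd 5 3 * progProd 5 5 * hG

theorem theta_mul_theta_eq_phi_mul_phi : theta 8 4 * theta 8 2 = phi 2 * phi 4 := by
  rw [phi_eq_progProd, phi_eq_progProd,
    progProd_eq_prod (K := 2) (d := 4) (by norm_num) (by norm_num) 2,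
    progProd_eq_prod (K := 4) (d := 2) (by norm_num) (by norm_num) 4, theta, theta]
  simp only [Finset.prod_range_succ, Finset.prod_range_zero, Nat.reduceMul, Nat.reduceAdd,
    Nat.reduceSub]
  ring

theorem neg_progProd {K a : ℕ} (hK : 0 < K) :
    Filter.Tendsto (fun N ↦ ∏ n ∈ Finset.range N, (1 - sgn (K * n + a : ℕ) * X ^ (K * n + a)))
      Filter.atTop (nhds (neg (progProd K a))) := by
  refine ((continuous_neg.tendsto _).comp (tendsto_progProd hK a)).congr fun N ↦ ?_
  simp only [Function.comp_apply, map_prod, map_sub, map_one, neg_X_pow]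

theorem neg_progProd_two_two : neg (progProd 2 2) = progProd 2 2 := by
  refine tendsto_nhds_unique (neg_progProd (by norm_num)) ?_
  refine (tendsto_progProd (by norm_num) 2).congr fun N ↦ Finset.prod_congr rfl fun n _ ↦ ?_
  have : sgn (2 * n + 2 : ℕ) = 1 := if_pos ⟨n + 1, by push_cast; ring⟩
  rw [this, one_mul]

theorem progProd_two_one_mul_neg : progProd 2 1 * neg (progProd 2 1) = progProd 4 2 := by
  refine tendsto_nhds_unique ((tendsto_progProd (by norm_num) 1).mul
    (neg_progProd (by norm_num))) ?_
  refine (tendsto_progProd (by norm_num) 2).congr fun N ↦ ?_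
  rw [← Finset.prod_mul_distrib]
  refine Finset.prod_congr rfl fun n _ ↦ ?_
  have : sgn (2 * n + 1 : ℕ) = -1 := if_neg (by rw [Int.even_iff]; omega)
  rw [this]
  ring

theorem neg_phi_two : neg (phi 2) = phi 2 := by
  rw [phi_eq_progProd, neg_progProd_two_two]

theorem phi_one_mul_neg_phi_one : phi 1 * neg (phi 1) * phi 4 = phi 2 ^ 3 := by
  have h1 : phi 1 = progProd 2 1 * progProd 2 2 := by
    rw [phi_eq_progProd, progProd_eq_prod (K := 1) (d := 2) (by norm_num) (by norm_num) 1]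
    simp [Finset.prod_range_succ]
  have h2 : progProd 2 2 = progProd 4 2 * progProd 4 4 := by
    rw [progProd_eq_prod (K := 2) (d := 2) (by norm_num) (by norm_num) 2]
    simp [Finset.prod_range_succ]
  rw [h1, phi_eq_progProd, phi_eq_progProd, map_mul, neg_progProd_two_two]
  linear_combination progProd 2 2 ^ 2 * progProd 4 4 * progProd_two_one_mul_neg -
    progProd 2 2 ^ 2 * h2

theorem neg_neg (f : ℚ⟦X⟧) : neg (neg f) = f := by
  simp [neg, rescale_rescale]

/-- **Watson's identity**, multiplied by `φ(X) φ(-X) = φ(X ^ 2) ^ 3 / φ(X ^ 4)`. -/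
theorem watson :
    phi 1 * neg (phi 1) * (H 1 * neg (G 1) + neg (H 1) * G 1) = 2 * (phi 2 * phi 4) := by
  have h := theta_mul_neg_theta_add
  rw [theta_mul_theta_eq_phi_mul_phi, ← phi_one_mul_H, ← phi_one_mul_G] at h
  simp only [map_mul, neg_neg] at h
  linear_combination h

end RogersRamanujan

open RogersRamanujan in
/-- `A` and `B` are the unique pair of power series solving the branching system
`H(t)A(t) + G(t)B(t) = 2φ(t²)²/φ(t)²`, `H(−t)A(t) − G(−t)B(t) = 0`. -/
theorem branching_system_unique_solution :
    (H 1 * A + G 1 * B = 2 * phi 2 ^ 2 * (phi 1 ^ 2)⁻¹ ∧ neg (H 1) * A - neg (G 1) * B = 0)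
      ∧ ∀ A' B' : PowerSeries ℚ,
          (H 1 * A' + G 1 * B' = 2 * phi 2 ^ 2 * (phi 1 ^ 2)⁻¹
            ∧ neg (H 1) * A' - neg (G 1) * B' = 0) → A' = A ∧ B' = B := by
  have hW := watson
  have hprod := phi_one_mul_neg_phi_one
  have h1 := phi_ne_zero (j := 1) one_pos
  have h2 := phi_ne_zero (j := 2) two_pos
  have h4 := phi_ne_zero (j := 4) four_pos
  have hv : neg v * phi 2 = neg (phi 1) := by
    have : v * phi 2 = phi 1 := by
      rw [v, mul_assoc, PowerSeries.inv_mul_cancel, mul_one]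
      rw [phi_eq_progProd, constantCoeff_progProd two_pos two_pos]
      exact one_ne_zero
    rw [← this, map_mul, neg_phi_two]
  have hW0 : H 1 * neg (G 1) + neg (H 1) * G 1 ≠ 0 := by
    intro h
    rw [h, mul_zero] at hW
    have two : (2 : ℚ⟦X⟧) ≠ 0 := fun h ↦ by
      simpa [← map_ofNat (C (R := ℚ))] using congrArg constantCoeff h
    exact mul_ne_zero two (mul_ne_zero h2 h4) hW.symm
  have hA : H 1 * A + G 1 * B = 2 * phi 2 ^ 2 * (phi 1 ^ 2)⁻¹ := by
    rw [PowerSeries.eq_mul_inv_iff_mul_eq]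
    · refine mul_right_cancel₀ (pow_ne_zero 2 h2) ?_
      rw [A, B]
      linear_combination (H 1 * neg (G 1) + neg (H 1) * G 1) * phi 1 ^ 2 *
        (neg v * phi 2 + neg (phi 1)) * hv + phi 1 * neg (phi 1) * hW + 2 * phi 2 * hprod
    · rw [map_pow, phi_eq_progProd, constantCoeff_progProd one_pos one_pos]
      norm_num
  have hB : neg (H 1) * A - neg (G 1) * B = 0 := by rw [A, B]; ring
  refine ⟨⟨hA, hB⟩, fun A' B' ⟨hA', hB'⟩ ↦ ⟨?_, ?_⟩⟩
  · refine mul_left_cancel₀ hW0 ?_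
    linear_combination neg (G 1) * (hA' - hA) + G 1 * (hB' - hB)
  · refine mul_left_cancel₀ hW0 ?_
    linear_combination neg (H 1) * (hA' - hA) - H 1 * (hB' - hB)
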